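/- Let Γ be a group and V a nonempty, homogeneous, irreducible variety over Γ. Suppose the group of functions L_V decomposes as a free product L_V = L^0 * G_1 * ⋯ * G_n * F_r with Γ contained in L^0, each G_i nontrivial, and F_r a free group of rank r, and suppose that every Γ-automorphism of L_V maps each G_i onto a conjugate of some G_j. Then n = 0; that is, L_V = L^0 * F_r. -/

import Mathlib

/-- The group of `Γ`-words in `d` variables: the free product `Γ ∗ F(x₁,…,x_d)`. -/
abbrev GWord (Γ : Type) [Group Γ] (d : ℕ) : Type := Monoid.Coprod Γ (FreeGroup (Fin d))

/-- Evaluation of `Γ`-words at a point of `Γ^d`: the homomorphism which is the identity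
on `Γ` and sends the `i`-th variable to `v i`. -/
def evalWord {Γ : Type} [Group Γ] {d : ℕ} (v : Fin d → Γ) : GWord Γ d →* Γ :=
  Monoid.Coprod.lift (MonoidHom.id Γ) (FreeGroup.lift v)

/-- The variety defined by a set `S` of `Γ`-words. -/
def varietyOf {Γ : Type} [Group Γ] {d : ℕ} (S : Set (GWord Γ d)) : Set (Fin d → Γ) :=
  { v | ∀ w ∈ S, evalWord v w = 1 }

/-- A subset of `Γ^d` is a variety if it is the common zero set of a set of `Γ`-words. -/
def IsVariety {Γ : Type} [Group Γ] {d : ℕ} (V : Set (Fin d → Γ)) : Prop :=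
  ∃ S : Set (GWord Γ d), V = varietyOf S

/-- The homomorphism sending a `Γ`-word to the function it defines on `V`. -/
def wordEval {Γ : Type} [Group Γ] {d : ℕ} (V : Set (Fin d → Γ)) : GWord Γ d →* (↥V → Γ) :=
  Pi.monoidHom fun v => evalWord (v : Fin d → Γ)

/-- The group `L_V` of word maps on `V`, as a subgroup of the group of all
functions `V → Γ` (with pointwise multiplication). -/
def LV {Γ : Type} [Group Γ] {d : ℕ} (V : Set (Fin d → Γ)) : Subgroup (↥V → Γ) :=
  (wordEval V).range

/-- The constant functions, as a homomorphism `Γ →* L_V`. -/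
def LV.const {Γ : Type} [Group Γ] {d : ℕ} (V : Set (Fin d → Γ)) : Γ →* ↥(LV V) :=
  (wordEval V).rangeRestrict.comp Monoid.Coprod.inl

/-- The `i`-th coordinate function, an element of `L_V`. -/
def LV.coord {Γ : Type} [Group Γ] {d : ℕ} (V : Set (Fin d → Γ)) (i : Fin d) : ↥(LV V) :=
  (wordEval V).rangeRestrict (Monoid.Coprod.inr (FreeGroup.of i))

/-- The evaluation homomorphism `h_v : L_V →* Γ` at a point `v ∈ V`. -/
def evalAt {Γ : Type} [Group Γ] {d : ℕ} (V : Set (Fin d → Γ)) (v : ↥V) : ↥(LV V) →* Γ :=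
  (Pi.evalMonoidHom (fun _ : ↥V => Γ) v).comp (LV V).subtype

/-- A family of homomorphisms `L →* Γ` is discriminating if every finite subset of `L`
is mapped injectively by some member of the family. -/
def IsDiscriminating {Γ L : Type} [Group Γ] [Group L] (H : Set (L →* Γ)) : Prop :=
  ∀ F : Finset L, ∃ h ∈ H, Set.InjOn h (F : Set L)

/-- A nonempty variety is irreducible if whenever it is a finite union of subvarieties,
one of them is the whole variety. -/
def IsIrreducibleVariety {Γ : Type} [Group Γ] {d : ℕ} (V : Set (Fin d → Γ)) : Prop :=
  IsVariety V ∧ V.Nonempty ∧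
    ∀ (n : ℕ) (W : Fin n → Set (Fin d → Γ)),
      (∀ k, IsVariety (W k)) → (∀ k, W k ⊆ V) → V = ⋃ k, W k → ∃ k, W k = V

/-- A map between varieties is algebraic if each of its coordinates is a word map. -/
def IsAlgebraicMap {Γ : Type} [Group Γ] {d d' : ℕ} (V : Set (Fin d → Γ))
    (V' : Set (Fin d' → Γ)) (F : ↥V → ↥V') : Prop :=
  ∀ i : Fin d', ∃ w : GWord Γ d, ∀ v : ↥V, (F v : Fin d' → Γ) i = evalWord (v : Fin d → Γ) w

/-- A variety is homogeneous if its algebraic automorphisms act transitively. -/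
def IsHomogeneous {Γ : Type} [Group Γ] {d : ℕ} (V : Set (Fin d → Γ)) : Prop :=
  ∀ v v' : ↥V, ∃ F : ↥V ≃ ↥V,
    IsAlgebraicMap V V ⇑F ∧ IsAlgebraicMap V V ⇑F.symm ∧ F v = v'

/-- An algebraic group over `Γ`: a nonempty variety `V ⊆ Γ^d` with a group law
whose coordinates are word maps on `V × V`. -/
structure AlgGroup (Γ : Type) [Group Γ] (d : ℕ) where
  carrier : Set (Fin d → Γ)
  isVariety : IsVariety carrier
  mul : ↥carrier → ↥carrier → ↥carrier
  one : ↥carrier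
  inv : ↥carrier → ↥carrier
  mul_assoc : ∀ a b c, mul (mul a b) c = mul a (mul b c)
  one_mul : ∀ a, mul one a = a
  mul_one : ∀ a, mul a one = a
  inv_mul : ∀ a, mul (inv a) a = one
  algebraic : ∀ i : Fin d, ∃ w : GWord Γ (d + d), ∀ a b : ↥carrier,
    (mul a b : Fin d → Γ) i = evalWord (Fin.append (a : Fin d → Γ) (b : Fin d → Γ)) w

/-- The group structure on the points of an algebraic group. -/
instance AlgGroup.group {Γ : Type} [Group Γ] {d : ℕ} (G : AlgGroup Γ d) :
    Group ↥G.carrier where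
  mul := G.mul
  one := G.one
  inv := G.inv
  mul_assoc := G.mul_assoc
  one_mul := G.one_mul
  mul_one := G.mul_one
  inv_mul_cancel := G.inv_mul

/-- The `Γ`-generating set of `L_V` consisting of the coordinate functions, their
inverses, and the nontrivial constants. -/
def LV.genSet {Γ : Type} [Group Γ] {d : ℕ} (V : Set (Fin d → Γ)) : Set ↥(LV V) :=
  {f | (∃ i, f = LV.coord V i ∨ f = (LV.coord V i)⁻¹) ∨ ∃ γ : Γ, γ ≠ 1 ∧ f = LV.const V γ}

/-- The length of an element of `L_V`: the minimal length of a word in the coordinate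
functions, their inverses, and nontrivial constants representing it. -/
noncomputable def LV.len {Γ : Type} [Group Γ] {d : ℕ} (V : Set (Fin d → Γ))
    (f : ↥(LV V)) : ℕ :=
  sInf {n | ∃ l : List ↥(LV V), l.length = n ∧ (∀ g ∈ l, g ∈ LV.genSet V) ∧ l.prod = f}
theorem pullback_mem {Γ : Type} [Group Γ] {d : ℕ} (V : Set (Fin d → Γ)) (F : ↥V → ↥V)
    (hF : IsAlgebraicMap V V F) (f : ↥V → Γ) (hf : f ∈ LV V) : f ∘ F ∈ LV V := by
  obtain ⟨w, rfl⟩ := hf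
  choose ws hws using hF
  refine ⟨Monoid.Coprod.lift Monoid.Coprod.inl (FreeGroup.lift ws) w, ?_⟩
  funext v
  change evalWord (v : Fin d → Γ) (Monoid.Coprod.lift Monoid.Coprod.inl (FreeGroup.lift ws) w)
    = evalWord (F v : Fin d → Γ) w
  have h : (evalWord (v : Fin d → Γ)).comp
      (Monoid.Coprod.lift Monoid.Coprod.inl (FreeGroup.lift ws) : GWord Γ d →* GWord Γ d)
      = evalWord (F v : Fin d → Γ) := by
    apply Monoid.Coprod.hom_ext
    · ext γ
      simp [evalWord]
    · ext i
      simp only [MonoidHom.comp_apply, Monoid.Coprod.lift_apply_inr, FreeGroup.lift_apply_of,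
        ← hws i v]
      simp [evalWord]
  exact DFunLike.congr_fun h w

/-- Pullback of word maps along an algebraic automorphism. -/
def pullbackEquiv {Γ : Type} [Group Γ] {d : ℕ} (V : Set (Fin d → Γ)) (F : ↥V ≃ ↥V)
    (hF : IsAlgebraicMap V V F) (hF' : IsAlgebraicMap V V F.symm) : ↥(LV V) ≃* ↥(LV V) where
  toFun f := ⟨f.1 ∘ F, pullback_mem V F hF f.1 f.2⟩
  invFun f := ⟨f.1 ∘ F.symm, pullback_mem V F.symm hF' f.1 f.2⟩
  left_inv f := by ext v; simp
  right_inv f := by ext v; simp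
  map_mul' f g := rfl

theorem const_apply_pt {Γ : Type} [Group Γ] {d : ℕ} (V : Set (Fin d → Γ)) (γ : Γ) (v : ↥V) :
    (LV.const V γ).1 v = γ := by
  change evalWord (v : Fin d → Γ) (Monoid.Coprod.inl γ) = γ
  simp [evalWord]

theorem exists_point {Γ : Type} [Group Γ] {d : ℕ} (V : Set (Fin d → Γ)) (hV : IsVariety V)
    (φ : ↥(LV V) →* Γ) (hφ : ∀ γ, φ (LV.const V γ) = γ) : ∃ v : ↥V, evalAt V v = φ := by
  have key : φ.comp (wordEval V).rangeRestrict = evalWord (fun i => φ (LV.coord V i)) := by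
    apply Monoid.Coprod.hom_ext
    · ext γ
      refine (hφ γ).trans ?_
      simp [evalWord]
    · ext i
      change φ (LV.coord V i) = _
      simp [evalWord]
  have hmem : (fun i => φ (LV.coord V i)) ∈ V := by
    obtain ⟨S, hS⟩ := hV
    have : ∀ w ∈ S, evalWord (fun i => φ (LV.coord V i)) w = 1 := by
      intro w hw
      rw [← key]
      have h1 : ((wordEval V).rangeRestrict w : ↥(LV V)) = 1 := by
        ext v
        have hv : (v : Fin d → Γ) ∈ varietyOf S := hS ▸ v.2
        exact hv w hw
      exact (congrArg φ h1).trans (map_one φ)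
    exact hS.symm.subset this
  refine ⟨⟨_, hmem⟩, ?_⟩
  ext ⟨f, w, rfl⟩
  exact (DFunLike.congr_fun key w).symm

/-- in a Grushko-type free decomposition
`L_V = L⁰ * G₁ * ⋯ * G_n * F_r` of the function group of a homogeneous irreducible
variety, with `Γ ⊆ L⁰` and the conjugacy classes of the `G_i` permuted by every
`Γ`-automorphism, there are no factors `G_i`, i.e. `n = 0`. -/
theorem stmt_7 {Γ : Type} [Group Γ] {d n r : ℕ} (V : Set (Fin d → Γ))
    (hV : IsVariety V) (hne : V.Nonempty) (hhom : IsHomogeneous V)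
    (hirr : IsIrreducibleVariety V)
    (L0 : Subgroup ↥(LV V)) (G : Fin n → Subgroup ↥(LV V)) (Fr : Subgroup ↥(LV V))
    (hconst : ∀ γ : Γ, LV.const V γ ∈ L0)
    (hGnt : ∀ i, G i ≠ ⊥)
    (hfree : Nonempty (↥Fr ≃* FreeGroup (Fin r)))
    (hdecomp : Function.Bijective
      (Monoid.CoprodI.lift
        (fun i : Unit ⊕ Fin n ⊕ Unit =>
          (Sum.elim (fun _ => L0) (Sum.elim G fun _ => Fr) i).subtype)))
    (hinv : ∀ α : ↥(LV V) ≃* ↥(LV V),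
      (∀ γ : Γ, α (LV.const V γ) = LV.const V γ) →
      ∀ i : Fin n, ∃ (j : Fin n) (g : ↥(LV V)),
        (G i).map α.toMonoidHom =
          (G j).map (MulEquiv.toMonoidHom (MulAut.conj g))) :
    n = 0 := by
  classical
  obtain ⟨v₁, hv₁⟩ := hne
  let K : Unit ⊕ Fin n ⊕ Unit → Subgroup ↥(LV V) :=
    Sum.elim (fun _ => L0) (Sum.elim G fun _ => Fr)
  let e := MulEquiv.ofBijective (Monoid.CoprodI.lift (fun i => (K i).subtype)) hdecomp
  let ψ : Monoid.CoprodI (fun i => ↥(K i)) →* Γ := Monoid.CoprodI.lift fun i =>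
    match i with
    | Sum.inl _ => (evalAt V ⟨v₁, hv₁⟩).comp L0.subtype
    | Sum.inr _ => 1
  let φ : ↥(LV V) →* Γ := ψ.comp e.symm.toMonoidHom
  have hφ : ∀ i (x : ↥(K i)), φ x.1 = ψ (Monoid.CoprodI.of x) := by
    intro i x
    change ψ (e.symm x.1) = _
    congr 1
    rw [MulEquiv.symm_apply_eq]
    exact (Monoid.CoprodI.lift_of (fun i => (K i).subtype) x).symm
  have hφc : ∀ γ, φ (LV.const V γ) = γ := by
    intro γ
    refine (hφ (Sum.inl ()) ⟨LV.const V γ, hconst γ⟩).trans ?_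
    refine (Monoid.CoprodI.lift_of _ _).trans ?_
    exact const_apply_pt V γ ⟨v₁, hv₁⟩
  have hφG : ∀ j, ∀ x ∈ G j, φ x = 1 := by
    intro j x hx
    refine (hφ (Sum.inr (Sum.inl j)) ⟨x, hx⟩).trans ?_
    exact Monoid.CoprodI.lift_of _ _
  obtain ⟨v₀, hv₀⟩ := exists_point V hV φ hφc
  by_contra hn
  let i : Fin n := ⟨0, Nat.pos_of_ne_zero hn⟩
  apply hGnt i
  rw [Subgroup.eq_bot_iff_forall]
  intro x hx
  ext v
  obtain ⟨F, hF, hF', hFv⟩ := hhom v₀ v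
  obtain ⟨j, g, hjg⟩ := hinv (pullbackEquiv V F hF hF') (by
    intro γ
    ext u
    exact (const_apply_pt V γ (F u)).trans (const_apply_pt V γ u).symm) i
  have hm : pullbackEquiv V F hF hF' x ∈
      (G j).map (MulEquiv.toMonoidHom (MulAut.conj g)) := by
    rw [← hjg]
    exact ⟨x, hx, rfl⟩
  obtain ⟨y, hy, hyx⟩ := hm
  have h1 : evalAt V v₀ (pullbackEquiv V F hF hF' x) = 1 := by
    rw [hv₀, ← hyx]
    simp [MulAut.conj_apply, hφG j y hy]
  rw [← hFv]
  exact h1
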